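/- Let d ≥ 2 be an integer, m ≥ 2 a real number, f : ℝ^d → ℝ a C² weight, and let v : ℝ^d → ℝ be a positive C³ solution of the v-equation 𝓛v = P := (1/v)·((m/2)|∇v|² + c_m). Define the pointwise quantity W_f[v] = ((m−d)/m²)(𝓛v)² + (2/m)(𝓛v)(∇f·∇v) + Hess f[∇v, ∇v], where Hess f is the second-derivative bilinear form of f. Then for every t ∈ ℝ the pointwise inequality holds at every x ∈ ℝ^d: (t − 1/2)·P^{t−2} v^{2−m} |∇P|² + m·P^{t−1} v^{1−m} W_f[v] ≤ div(P^{t−1} v^{2−m} ∇P) − ∇f·(P^{t−1} v^{2−m} ∇P), where div X denotes the divergence (trace of the derivative) of the C¹ vector field X = P^{t−1} v^{2−m} ∇P. [Euclidean-base, n = ∞ instance of the pointwise Lemma of Section 3.] -/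

import Mathlib

open Real MeasureTheory Filter
open scoped RealInnerProductSpace

/-- Euclidean Laplacian: trace of the second derivative. -/
noncomputable def lapl {d : ℕ} (u : EuclideanSpace ℝ (Fin d) → ℝ)
    (x : EuclideanSpace ℝ (Fin d)) : ℝ :=
  ∑ i : Fin d, iteratedFDeriv ℝ 2 u x ![EuclideanSpace.single i 1, EuclideanSpace.single i 1]

/-- The constant c_m: 2/(m−2) for m > 2 and 1/2 for m = 2. -/
noncomputable def cm (m : ℝ) : ℝ := if m = 2 then 1/2 else 2/(m-2)

/-- Divergence of a vector field on Euclidean space. -/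
noncomputable def diverg {d : ℕ}
    (X : EuclideanSpace ℝ (Fin d) → EuclideanSpace ℝ (Fin d))
    (x : EuclideanSpace ℝ (Fin d)) : ℝ :=
  ∑ i : Fin d, ⟪fderiv ℝ X x (EuclideanSpace.single i 1), EuclideanSpace.single i 1⟫

/-- Partial derivative in the i-th coordinate direction. -/
noncomputable def pd {d : ℕ} (i : Fin d) (g : EuclideanSpace ℝ (Fin d) → ℝ)
    (x : EuclideanSpace ℝ (Fin d)) : ℝ := fderiv ℝ g x (EuclideanSpace.single i 1)

section aux
variable {d : ℕ}

lemma pd_contDiff {n : WithTop ℕ∞} {k : WithTop ℕ∞} (hk : n + 1 ≤ k) (i : Fin d)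
    {g : EuclideanSpace ℝ (Fin d) → ℝ} (hg : ContDiff ℝ k g) : ContDiff ℝ n (pd i g) := by
  unfold pd
  exact (hg.fderiv_right hk).clm_apply contDiff_const

lemma pd_mul (i : Fin d) {g h : EuclideanSpace ℝ (Fin d) → ℝ} {x : EuclideanSpace ℝ (Fin d)}
    (hg : DifferentiableAt ℝ g x) (hh : DifferentiableAt ℝ h x) :
    pd i (fun y => g y * h y) x = pd i g x * h x + g x * pd i h x := by
  unfold pd
  rw [fderiv_fun_mul hg hh]
  simp
  ring

lemma pd_add (i : Fin d) {g h : EuclideanSpace ℝ (Fin d) → ℝ} {x : EuclideanSpace ℝ (Fin d)}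
    (hg : DifferentiableAt ℝ g x) (hh : DifferentiableAt ℝ h x) :
    pd i (fun y => g y + h y) x = pd i g x + pd i h x := by
  unfold pd
  rw [fderiv_fun_add hg hh]
  simp

lemma pd_const (i : Fin d) (c : ℝ) (x : EuclideanSpace ℝ (Fin d)) :
    pd i (fun _ => c) x = 0 := by
  unfold pd
  simp

lemma pd_sum (i : Fin d) {g : Fin d → EuclideanSpace ℝ (Fin d) → ℝ}
    {x : EuclideanSpace ℝ (Fin d)} (hg : ∀ j, DifferentiableAt ℝ (g j) x) :
    pd i (fun y => ∑ j, g j y) x = ∑ j, pd i (g j) x := by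
  unfold pd
  rw [fderiv_fun_sum (fun j _ => hg j)]
  simp

lemma pd_rpow (i : Fin d) {g : EuclideanSpace ℝ (Fin d) → ℝ} {x : EuclideanSpace ℝ (Fin d)}
    (hg : DifferentiableAt ℝ g x) (hx : 0 < g x) (s : ℝ) :
    pd i (fun y => g y ^ s) x = s * g x ^ (s - 1) * pd i g x := by
  unfold pd
  rw [(hg.hasFDerivAt.rpow_const (Or.inl hx.ne')).fderiv]
  simp

lemma iter_eq {g : EuclideanSpace ℝ (Fin d) → ℝ} (hg : ContDiff ℝ 2 g)
    (x a b : EuclideanSpace ℝ (Fin d)) :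
    iteratedFDeriv ℝ 2 g x ![a, b] = fderiv ℝ (fderiv ℝ g) x a b := by
  rw [iteratedFDeriv_two_apply]
  simp

lemma pd_pd {g : EuclideanSpace ℝ (Fin d) → ℝ} (hg : ContDiff ℝ 2 g)
    (x : EuclideanSpace ℝ (Fin d)) (i j : Fin d) :
    pd i (pd j g) x
      = fderiv ℝ (fderiv ℝ g) x (EuclideanSpace.single i 1) (EuclideanSpace.single j 1) := by
  have h1 : DifferentiableAt ℝ (fderiv ℝ g) x :=
    ((hg.fderiv_right (m := 1) (by norm_num)).differentiable (by norm_num)) x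
  unfold pd
  rw [fderiv_clm_apply h1 (differentiableAt_const _)]
  simp

lemma pd_comm {g : EuclideanSpace ℝ (Fin d) → ℝ} (hg : ContDiff ℝ 2 g)
    (x : EuclideanSpace ℝ (Fin d)) (i j : Fin d) :
    pd i (pd j g) x = pd j (pd i g) x := by
  rw [pd_pd hg, pd_pd hg]
  exact (hg.contDiffAt.isSymmSndFDerivAt (by simp)) _ _

lemma grad_apply {g : EuclideanSpace ℝ (Fin d) → ℝ}
    (x : EuclideanSpace ℝ (Fin d)) (i : Fin d) : gradient g x i = pd i g x := by
  have h : ⟪gradient g x, EuclideanSpace.single i (1:ℝ)⟫ = pd i g x := by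
    unfold gradient pd
    simp
  rw [← h, EuclideanSpace.inner_single_right]
  simp

lemma inner_eq (a b : EuclideanSpace ℝ (Fin d)) : ⟪a, b⟫ = ∑ i, a i * b i := by
  rw [PiLp.inner_apply]
  exact Finset.sum_congr rfl (fun i _ => by simp [mul_comm])

lemma normsq_eq (a : EuclideanSpace ℝ (Fin d)) : ‖a‖ ^ 2 = ∑ i, a i ^ 2 := by
  rw [EuclideanSpace.norm_sq_eq]
  simp

lemma lapl_eq {g : EuclideanSpace ℝ (Fin d) → ℝ} (hg : ContDiff ℝ 2 g)
    (x : EuclideanSpace ℝ (Fin d)) : lapl g x = ∑ i, pd i (pd i g) x := by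
  unfold lapl
  exact Finset.sum_congr rfl (fun i _ => by rw [iter_eq hg, pd_pd hg])

lemma vec_eq (a : EuclideanSpace ℝ (Fin d)) :
    a = ∑ i, a i • EuclideanSpace.single i (1:ℝ) := by
  ext j
  simp [Pi.single_apply]

lemma hess_eq {g : EuclideanSpace ℝ (Fin d) → ℝ} (hg : ContDiff ℝ 2 g)
    (x a : EuclideanSpace ℝ (Fin d)) :
    iteratedFDeriv ℝ 2 g x ![a, a] = ∑ i, ∑ j, a i * a j * pd i (pd j g) x := by
  rw [iter_eq hg]
  conv_lhs => rw [vec_eq a]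
  simp only [map_sum, _root_.sum_apply, map_smul, _root_.smul_apply,
    smul_eq_mul, Finset.mul_sum]
  rw [Finset.sum_comm]
  refine Finset.sum_congr rfl (fun i _ => Finset.sum_congr rfl (fun j _ => ?_))
  rw [pd_pd hg]
  ring

lemma diverg_eq {X : EuclideanSpace ℝ (Fin d) → EuclideanSpace ℝ (Fin d)}
    {x : EuclideanSpace ℝ (Fin d)} (hX : DifferentiableAt ℝ X x) :
    diverg X x = ∑ i, pd i (fun y => X y i) x := by
  unfold diverg pd
  refine Finset.sum_congr rfl (fun i _ => ?_)
  have h := ((EuclideanSpace.proj i : EuclideanSpace ℝ (Fin d) →L[ℝ] ℝ).hasFDerivAt.comp x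
    hX.hasFDerivAt).fderiv
  have h2 : fderiv ℝ (fun y => X y i) x
      = (EuclideanSpace.proj i : EuclideanSpace ℝ (Fin d) →L[ℝ] ℝ).comp (fderiv ℝ X x) := h
  rw [h2, EuclideanSpace.inner_single_right]
  simp

/-- Pointwise algebra: the final inequality, after dividing out the positive powers. -/
lemma algebra_core (m c P v : ℝ) (hm : 2 ≤ m) (hc : 0 < c) (hv : 0 < v)
    (u p F : Fin d → ℝ) (H : Fin d → Fin d → ℝ)
    (h1 : P * v = m / 2 * (∑ i, u i ^ 2) + c)
    (h2 : ∀ i, p i * v + P * u i = m * ∑ j, u j * H i j)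
    (h4 : ∑ i, H i i = P + ∑ i, F i * u i) :
    1 / 2 * v * (∑ i, p i ^ 2) + P * ((m - d) / m * P ^ 2 + 2 * P * ∑ i, F i * u i)
      ≤ P * (m * (∑ i, ∑ j, H i j ^ 2) - P ^ 2) := by
  have hm0 : 0 < m := by linarith
  have hu : 0 ≤ ∑ i, u i ^ 2 := Finset.sum_nonneg (fun i _ => sq_nonneg _)
  have hPpos : 0 < P := by
    have : 0 < P * v := by rw [h1]; positivity
    exact pos_of_mul_pos_left this hv.le
  set A : Fin d → Fin d → ℝ := fun i j => H i j - if i = j then P / m else 0 with hA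
  have hAu : ∀ i, v * p i = m * ∑ j, A i j * u j := by
    intro i
    have : ∑ j, A i j * u j = (∑ j, u j * H i j) - P / m * u i := by
      simp only [hA, sub_mul, Finset.sum_sub_distrib, ite_mul, zero_mul, Finset.sum_ite_eq,
        Finset.mem_univ, if_true]
      simp only [mul_comm]
    rw [this]
    have := h2 i
    field_simp
    linarith
  have hAA : ∑ i, ∑ j, A i j ^ 2
      = (∑ i, ∑ j, H i j ^ 2) - 2 * (P / m) * (∑ i, H i i) + d * (P / m) ^ 2 := by
    have e : ∀ i j, A i j ^ 2 = H i j ^ 2 - (if i = j then 2 * (P / m) * H i j else 0)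
        + (if i = j then (P / m) ^ 2 else 0) := by
      intro i j
      simp only [hA]
      split_ifs <;> ring
    simp only [e, Finset.sum_add_distrib, Finset.sum_sub_distrib, Finset.sum_ite_eq,
      Finset.mem_univ, if_true, ← Finset.mul_sum]
    simp
  have hAn : 0 ≤ ∑ i, ∑ j, A i j ^ 2 :=
    Finset.sum_nonneg (fun i _ => Finset.sum_nonneg (fun j _ => sq_nonneg _))
  have hCS : v ^ 2 * (∑ i, p i ^ 2) ≤ m ^ 2 * ((∑ i, ∑ j, A i j ^ 2) * ∑ i, u i ^ 2) := by
    rw [Finset.mul_sum, Finset.sum_mul, Finset.mul_sum]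
    refine Finset.sum_le_sum (fun i _ => ?_)
    have h := Finset.sum_mul_sq_le_sq_mul_sq Finset.univ (A i) u
    have : v ^ 2 * p i ^ 2 = m ^ 2 * (∑ j, A i j * u j) ^ 2 := by
      rw [← mul_pow, hAu i, mul_pow]
    rw [this]
    exact mul_le_mul_of_nonneg_left h (by positivity)
  set S := ∑ i, ∑ j, A i j ^ 2
  set U := ∑ i, u i ^ 2
  set a := ∑ i, F i * u i
  have hkey : 1 / 2 * v * (∑ i, p i ^ 2) ≤ P * (m * S) := by
    have h5 : m / 2 * U ≤ P * v := by linarith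
    have h6 : m * S * (m / 2 * U) ≤ m * S * (P * v) :=
      mul_le_mul_of_nonneg_left h5 (by positivity)
    have h7 : v * (1 / 2 * v * (∑ i, p i ^ 2)) ≤ v * (P * (m * S)) := by nlinarith
    exact le_of_mul_le_mul_left h7 hv
  have hid : P * (m * (∑ i, ∑ j, H i j ^ 2) - P ^ 2)
      = P * (m * S) + P * ((m - d) / m * P ^ 2 + 2 * P * a) := by
    rw [hAA, h4]
    field_simp
    ring
  rw [hid]
  linarith

end aux

/-- Euclidean-base, n = ∞ instance of the pointwise Lemma of Section 3:
the fundamental pointwise inequality (fund-pw-ineq-eq) for positive solutions of the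
v-equation, with W_f[v] = ((m−d)/m²)(𝓛v)² + (2/m)(𝓛v)(∇f·∇v) + Hess f[∇v,∇v]. -/
theorem fundamental_pointwise_inequality
    (d : ℕ) (hd : 2 ≤ d) (m : ℝ) (hm : 2 ≤ m)
    (f v P : EuclideanSpace ℝ (Fin d) → ℝ)
    (hf : ContDiff ℝ 2 f) (hv : ContDiff ℝ 3 v) (hvpos : ∀ x, 0 < v x)
    (hP : ∀ x, P x = (1 / v x) * ((m / 2) * ‖gradient v x‖ ^ 2 + cm m))
    (hveq : ∀ x, lapl v x - ⟪gradient f x, gradient v x⟫ = P x) :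
    ∀ (t : ℝ) (x : EuclideanSpace ℝ (Fin d)),
      (t - 1/2) * P x ^ (t - 2) * v x ^ (2 - m) * ‖gradient P x‖ ^ 2
        + m * P x ^ (t - 1) * v x ^ (1 - m) *
          (((m - (d : ℝ)) / m ^ 2) * (lapl v x - ⟪gradient f x, gradient v x⟫) ^ 2
            + (2 / m) * (lapl v x - ⟪gradient f x, gradient v x⟫)
                * ⟪gradient f x, gradient v x⟫
            + iteratedFDeriv ℝ 2 f x ![gradient v x, gradient v x])
      ≤ diverg (fun y => (P y ^ (t - 1) * v y ^ (2 - m)) • gradient P y) x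
          - ⟪gradient f x, (P x ^ (t - 1) * v x ^ (2 - m)) • gradient P x⟫ := by
  have hc : 0 < cm m := by
    unfold cm
    split_ifs with h
    · norm_num
    · have : 2 < m := lt_of_le_of_ne hm (Ne.symm h)
      exact div_pos (by norm_num) (by linarith)
  have hv2 : ContDiff ℝ 2 v := hv.of_le (by norm_num)
  have hV : ∀ i, ContDiff ℝ 2 (pd i v) := fun i => pd_contDiff (by norm_num) i hv
  have hVV : ∀ i j, ContDiff ℝ 1 (pd i (pd j v)) := fun i j =>
    pd_contDiff (by norm_num) i (hV j)
  have hF : ∀ i, ContDiff ℝ 1 (pd i f) := fun i => pd_contDiff (by norm_num) i hf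
  have hP' : ∀ x, P x = (1 / v x) * ((m / 2) * (∑ i, pd i v x * pd i v x) + cm m) := by
    intro x
    rw [hP x, normsq_eq]
    simp only [grad_apply, pow_two]
  have hPc : ContDiff ℝ 2 P := by
    have : P = fun x => (1 / v x) * ((m / 2) * (∑ i, pd i v x * pd i v x) + cm m) := funext hP'
    rw [this]
    refine (contDiff_const.div hv2 (fun x => (hvpos x).ne')).mul
      ((contDiff_const.mul (ContDiff.sum (fun i _ => (hV i).mul (hV i)))).add contDiff_const)
  have hPP : ∀ i, ContDiff ℝ 1 (pd i P) := fun i => pd_contDiff (by norm_num) i hPc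
  have hPpos : ∀ x, 0 < P x := by
    intro x
    rw [hP x]
    have := hvpos x
    positivity
  -- differentiability
  have dv : ∀ x, DifferentiableAt ℝ v x := fun x => hv.differentiable (by norm_num) x
  have dP : ∀ x, DifferentiableAt ℝ P x := fun x => hPc.differentiable (by norm_num) x
  have dV : ∀ i x, DifferentiableAt ℝ (pd i v) x :=
    fun i x => (hV i).differentiable (by norm_num) x
  have dVV : ∀ i j x, DifferentiableAt ℝ (pd i (pd j v)) x :=
    fun i j x => (hVV i j).differentiable (by norm_num) x
  have dF : ∀ i x, DifferentiableAt ℝ (pd i f) x :=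
    fun i x => (hF i).differentiable (by norm_num) x
  have dPP : ∀ i x, DifferentiableAt ℝ (pd i P) x :=
    fun i x => (hPP i).differentiable (by norm_num) x
  -- identities
  have e1 : ∀ x, P x * v x = m / 2 * (∑ j, pd j v x * pd j v x) + cm m := by
    intro x
    rw [hP' x]
    have := (hvpos x).ne'
    field_simp
  have e2 : ∀ i x, pd i P x * v x + P x * pd i v x = m * ∑ j, pd j v x * pd i (pd j v) x := by
    intro i x
    have h : pd i (fun y => P y * v y) x
        = pd i (fun y => m / 2 * (∑ j, pd j v y * pd j v y) + cm m) x := by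
      congr 1
      exact funext e1
    have ds : DifferentiableAt ℝ (fun y => ∑ j, pd j v y * pd j v y) x :=
      DifferentiableAt.fun_sum (fun j _ => (dV j x).fun_mul (dV j x))
    rw [pd_mul i (dP x) (dv x), pd_add i ((differentiableAt_const _).fun_mul ds)
      (differentiableAt_const _), pd_mul i (differentiableAt_const _) ds, pd_const, pd_const,
      pd_sum i (fun j => (dV j x).fun_mul (dV j x))] at h
    rw [h]
    simp only [pd_mul i (dV _ x) (dV _ x), Finset.sum_add_distrib]
    simp only [mul_comm (pd i (pd _ v) x)]
    ring
  have e3 : ∀ i x, pd i (pd i P) x * v x + 2 * (pd i P x * pd i v x) + P x * pd i (pd i v) x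
      = m * ∑ j, (pd i (pd j v) x ^ 2 + pd j v x * pd j (pd i (pd i v)) x) := by
    intro i x
    have h : pd i (fun y => pd i P y * v y + P y * pd i v y) x
        = pd i (fun y => m * ∑ j, pd j v y * pd i (pd j v) y) x := by
      congr 1
      exact funext (e2 i)
    have ds : DifferentiableAt ℝ (fun y => ∑ j, pd j v y * pd i (pd j v) y) x :=
      DifferentiableAt.fun_sum (fun j _ => (dV j x).fun_mul (dVV i j x))
    rw [pd_add i ((dPP i x).fun_mul (dv x)) ((dP x).fun_mul (dV i x)), pd_mul i (dPP i x) (dv x),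
      pd_mul i (dP x) (dV i x), pd_mul i (differentiableAt_const _) ds, pd_const,
      pd_sum i (fun j => (dV j x).fun_mul (dVV i j x))] at h
    simp only [pd_mul i (dV _ x) (dVV i _ x)] at h
    have hs : ∀ j, pd i (pd i (pd j v)) x = pd j (pd i (pd i v)) x := by
      intro j
      have : pd i (pd j v) = pd j (pd i v) := funext (fun y => pd_comm hv2 y i j)
      rw [this, pd_comm (hV i) x i j]
    simp only [hs] at h
    simp only [pow_two]
    linarith
  have e4 : ∀ x, ∑ i, pd i (pd i v) x = P x + ∑ k, pd k f x * pd k v x := by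
    intro x
    have := hveq x
    rw [lapl_eq hv2, inner_eq] at this
    simp only [grad_apply] at this
    linarith
  have e5 : ∀ j x, ∑ i, pd j (pd i (pd i v)) x
      = pd j P x + ∑ k, (pd j (pd k f) x * pd k v x + pd k f x * pd j (pd k v) x) := by
    intro j x
    have h : pd j (fun y => ∑ i, pd i (pd i v) y) x
        = pd j (fun y => P y + ∑ k, pd k f y * pd k v y) x := by
      congr 1
      exact funext e4
    rw [pd_sum j (fun i => dVV i i x), pd_add j (dP x)
      (DifferentiableAt.fun_sum (fun k _ => (dF k x).fun_mul (dV k x))),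
      pd_sum j (fun k => (dF k x).fun_mul (dV k x))] at h
    simp only [pd_mul j (dF _ x) (dV _ x)] at h
    exact h
  intro t x
  have dw : ∀ y, DifferentiableAt ℝ (fun y => P y ^ (t - 1) * v y ^ (2 - m)) y := fun y =>
    ((dP y).rpow_const (Or.inl (hPpos y).ne')).fun_mul ((dv y).rpow_const (Or.inl (hvpos y).ne'))
  have dgrad : DifferentiableAt ℝ (gradient P) x := by
    rw [differentiableAt_euclidean]
    intro i
    simp only [grad_apply]
    exact dPP i x
  rw [diverg_eq ((dw x).fun_smul dgrad), hveq x, hess_eq hf, normsq_eq, inner_eq, inner_eq]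
  simp only [PiLp.smul_apply, smul_eq_mul, grad_apply]
  have ediv : ∀ i, pd i (fun y => P y ^ (t - 1) * v y ^ (2 - m) * pd i P y) x
      = (t - 1) * P x ^ (t - 2) * v x ^ (2 - m) * pd i P x ^ 2
        + (2 - m) * P x ^ (t - 1) * v x ^ (1 - m) * (pd i P x * pd i v x)
        + P x ^ (t - 1) * v x ^ (2 - m) * pd i (pd i P) x := by
    intro i
    rw [pd_mul i (dw x) (dPP i x),
      pd_mul i ((dP x).rpow_const (Or.inl (hPpos x).ne'))
        ((dv x).rpow_const (Or.inl (hvpos x).ne')),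
      pd_rpow i (dP x) (hPpos x), pd_rpow i (dv x) (hvpos x)]
    rw [show t - 1 - 1 = t - 2 by ring, show 2 - m - 1 = 1 - m by ring]
    ring
  simp only [ediv, Finset.sum_add_distrib, ← Finset.mul_sum]
  have efin : ∑ i, pd i f x * (P x ^ (t - 1) * v x ^ (2 - m) * pd i P x)
      = P x ^ (t - 1) * v x ^ (2 - m) * ∑ i, pd i f x * pd i P x := by
    rw [Finset.mul_sum]
    exact Finset.sum_congr rfl (fun i _ => by ring)
  rw [efin]
  have r1 : P x ^ (t - 1) = P x ^ (t - 2) * P x := by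
    rw [show t - 1 = (t - 2) + 1 by ring, Real.rpow_add_one (hPpos x).ne']
  have r2 : v x ^ (2 - m) = v x ^ (1 - m) * v x := by
    rw [show 2 - m = (1 - m) + 1 by ring, Real.rpow_add_one (hvpos x).ne']
  rw [r1, r2]
  have q1 : 0 < P x ^ (t - 2) := Real.rpow_pos_of_pos (hPpos x) _
  have q2 : 0 < v x ^ (1 - m) := Real.rpow_pos_of_pos (hvpos x) _
  have core := algebra_core m (cm m) (P x) (v x) hm hc (hvpos x) (fun i => pd i v x)
    (fun i => pd i P x) (fun i => pd i f x) (fun i j => pd i (pd j v) x)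
    (by simpa only [pow_two] using e1 x) (fun i => e2 i x) (e4 x)
  -- the Bochner-type identity
  have boch : v x * ((∑ i, pd i (pd i P) x) - ∑ i, pd i f x * pd i P x)
      = m * (∑ i, ∑ j, pd i (pd j v) x ^ 2) - P x ^ 2 + (m - 2) * (∑ i, pd i P x * pd i v x)
        + m * ∑ i, ∑ j, pd i v x * pd j v x * pd i (pd j f) x := by
    have s3 : (∑ i, pd i (pd i P) x) * v x + 2 * (∑ i, pd i P x * pd i v x)
        + P x * ∑ i, pd i (pd i v) x
        = m * (∑ i, ∑ j, pd i (pd j v) x ^ 2)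
          + m * ∑ i, ∑ j, pd j v x * pd j (pd i (pd i v)) x := by
      have := Finset.sum_congr (rfl : (Finset.univ : Finset (Fin d)) = Finset.univ)
        (fun i _ => e3 i x)
      simp only [Finset.sum_add_distrib, ← Finset.mul_sum, ← Finset.sum_mul] at this
      rw [this]
      ring
    have s5 : ∑ i, ∑ j, pd j v x * pd j (pd i (pd i v)) x
        = (∑ i, pd i P x * pd i v x)
          + (∑ i, ∑ j, pd i v x * pd j v x * pd i (pd j f) x)
          + ∑ i, pd i f x * ∑ j, pd j v x * pd i (pd j v) x := by
      rw [Finset.sum_comm]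
      simp only [← Finset.mul_sum, e5]
      simp only [mul_add, Finset.sum_add_distrib, Finset.mul_sum]
      rw [← add_assoc]
      congr 1
      · congr 1
        · exact Finset.sum_congr rfl (fun i _ => by ring)
        · exact Finset.sum_congr rfl (fun i _ => Finset.sum_congr rfl (fun j _ => by ring))
      · rw [Finset.sum_comm]
        refine Finset.sum_congr rfl (fun i _ => Finset.sum_congr rfl (fun j _ => ?_))
        rw [pd_comm hv2 x j i]
        ring
    have s2 : m * ∑ i, pd i f x * ∑ j, pd j v x * pd i (pd j v) x
        = v x * (∑ i, pd i f x * pd i P x) + P x * ∑ i, pd i f x * pd i v x := by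
      rw [Finset.mul_sum, Finset.mul_sum, Finset.mul_sum, ← Finset.sum_add_distrib]
      refine Finset.sum_congr rfl (fun i _ => ?_)
      have := e2 i x
      linear_combination (-pd i f x) * this
    rw [s5, e4 x] at s3
    linear_combination s3 + s2
  have hm0 : m ≠ 0 := by linarith
  have fin := mul_le_mul_of_nonneg_left core (mul_pos q1 q2).le
  rw [← sub_nonneg] at fin ⊢
  refine le_of_le_of_eq fin ?_
  field_simp
  linear_combination (-(2 * m * P x)) * boch
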